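/- Let B > 0 be a fixed constant and let A be any finite constant with A > B. There exists a constant c > 0, depending only on A and B, such that for all d ≥ 2 and all k ≥ 1, the stretched maximum-likelihood estimator θ̂⁽ᴬ⁾ (the unique minimizer of the negative log-likelihood ℓ over Θ_A) satisfies sup_{θ* ∈ Θ_B} E[‖θ̂⁽ᴬ⁾ − θ*‖₂²] ≤ c/k. -/

import Mathlib

open Finset

/-- The sigmoid (logistic) function `σ(x) = 1/(1+e^{-x})`. -/
noncomputable def sigmoid (x : ℝ) : ℝ := 1 / (1 + Real.exp (-x))

/-- Probability that `Binomial(k, p) = w`. -/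
noncomputable def binomProb (k : ℕ) (p : ℝ) (w : ℕ) : ℝ :=
  (k.choose w : ℝ) * p ^ w * (1 - p) ^ (k - w)

/-- Sample space for the league format: for each pair `i < j`, the number of wins
of item `i` over item `j` among the `k` comparisons of that pair. -/
abbrev BTLOutcome (d k : ℕ) := {q : Fin d × Fin d // q.1 < q.2} → Fin (k + 1)

/-- Joint probability of an outcome: independent `Binomial(k, σ(θ_i - θ_j))`
win counts across the pairs `i < j`. -/
noncomputable def outcomeProb (d k : ℕ) (θ : Fin d → ℝ) (w : BTLOutcome d k) : ℝ :=
  ∏ q : {q : Fin d × Fin d // q.1 < q.2},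
    binomProb k (sigmoid (θ q.1.1 - θ q.1.2)) (w q : ℕ)

/-- The full win-count matrix `W_ij` determined by an outcome (`W_ji = k - W_ij`). -/
def winCount (d k : ℕ) (w : BTLOutcome d k) (i j : Fin d) : ℕ :=
  if h : i < j then (w ⟨(i, j), h⟩ : ℕ)
  else if h' : j < i then k - (w ⟨(j, i), h'⟩ : ℕ)
  else 0

/-- The observed fraction of wins `μ_ij = W_ij / k`. -/
noncomputable def winFrac (d k : ℕ) (w : BTLOutcome d k) (i j : Fin d) : ℝ :=
  (winCount d k w i j : ℝ) / (k : ℝ)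

/-- The negative log-likelihood
`ℓ(θ) = k ∑_{i<j} [log(e^{θ_i}+e^{θ_j}) - μ_ij θ_i - μ_ji θ_j]`. -/
noncomputable def nll (d k : ℕ) (μ : Fin d → Fin d → ℝ) (θ : Fin d → ℝ) : ℝ :=
  (k : ℝ) * ∑ i : Fin d, ∑ j : Fin d,
    if i < j then
      Real.log (Real.exp (θ i) + Real.exp (θ j)) - μ i j * θ i - μ j i * θ j
    else 0

/-- The parameter domain `Θ_B = {θ : ‖θ‖_∞ ≤ B, ∑ θ_i = 0}`
(the norm on `Fin d → ℝ` is the sup norm). -/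
def paramSet (d : ℕ) (B : ℝ) : Set (Fin d → ℝ) :=
  {θ | ‖θ‖ ≤ B ∧ ∑ i, θ i = 0}

/-- The expectation (under true parameter `θ*`) of an estimator. -/
noncomputable def expVec (d k : ℕ) (θstar : Fin d → ℝ)
    (est : BTLOutcome d k → Fin d → ℝ) : Fin d → ℝ :=
  fun m => ∑ w : BTLOutcome d k, outcomeProb d k θstar w * est w m

theorem sigmoid_eq_real_sigmoid (x : ℝ) : sigmoid x = Real.sigmoid x := by
  rw [sigmoid, Real.sigmoid_def, one_div]

theorem hasDerivAt_softplus (x : ℝ) :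
    HasDerivAt (fun y => Real.log (1 + Real.exp y)) (sigmoid x) x := by
  have h1 : HasDerivAt (fun y => 1 + Real.exp y) (Real.exp x) x :=
    (Real.hasDerivAt_exp x).const_add 1
  have hpos : 0 < 1 + Real.exp x := by positivity
  convert h1.log hpos.ne' using 1
  rw [sigmoid, Real.exp_neg]
  field_simp
  ring

theorem ConvexOn.tangent_le {S : Set ℝ} {f : ℝ → ℝ} {f' x y : ℝ} (hf : ConvexOn ℝ S f)
    (hx : x ∈ S) (hy : y ∈ S) (hf' : HasDerivAt f f' x) : f x + f' * (y - x) ≤ f y := by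
  rcases lt_trichotomy x y with h | rfl | h
  · have := hf.le_slope_of_hasDerivAt hx hy h hf'
    rw [slope_def_field, le_div_iff₀ (sub_pos.2 h)] at this
    linarith
  · simp
  · have := hf.slope_le_of_hasDerivAt hy hx h hf'
    rw [slope_def_field, div_le_iff₀ (sub_pos.2 h)] at this
    linarith

/-- On `[-M, M]` the softplus function is strongly convex with modulus `σ(-M)²`. -/
theorem softplus_strong_convexity {M x y : ℝ} (hx : x ∈ Set.Icc (-M) M)
    (hy : y ∈ Set.Icc (-M) M) :
    Real.log (1 + Real.exp x) + sigmoid x * (y - x) + sigmoid (-M) ^ 2 / 2 * (y - x) ^ 2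
      ≤ Real.log (1 + Real.exp y) := by
  set κ := sigmoid (-M) ^ 2 with hκ
  have hd : ∀ z, HasDerivAt (fun y => Real.log (1 + Real.exp y) - κ / 2 * y ^ 2)
      (sigmoid z - κ * z) z := fun z => by
    refine ((hasDerivAt_softplus z).fun_sub
      ((hasDerivAt_pow 2 z).const_mul (κ / 2))).congr_deriv ?_
    norm_num
    ring
  have hd2 : ∀ z, HasDerivAt (fun y => sigmoid y - κ * y)
      (Real.sigmoid z * (1 - Real.sigmoid z) - κ) z := fun z => by
    simp only [sigmoid_eq_real_sigmoid]
    simpa using (Real.hasDerivAt_sigmoid z).fun_sub ((hasDerivAt_id z).const_mul κ)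
  have hconv : ConvexOn ℝ (Set.Icc (-M) M)
      (fun y => Real.log (1 + Real.exp y) - κ / 2 * y ^ 2) := by
    refine convexOn_of_hasDerivWithinAt2_nonneg (convex_Icc _ _)
      (fun z _ => (hd z).continuousAt.continuousWithinAt)
      (fun z _ => (hd z).hasDerivWithinAt) (fun z _ => (hd2 z).hasDerivWithinAt) ?_
    intro z hz
    have hz := interior_subset hz
    have h1 : Real.sigmoid (-M) ≤ Real.sigmoid z := Real.sigmoid_le hz.1
    have h2 : Real.sigmoid (-M) ≤ 1 - Real.sigmoid z := by
      rw [← Real.sigmoid_neg]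
      exact Real.sigmoid_le (by linarith [hz.2])
    have h0 := Real.sigmoid_pos (-M)
    rw [hκ, sigmoid_eq_real_sigmoid, sub_nonneg, sq]
    exact mul_le_mul h1 h2 h0.le (Real.sigmoid_nonneg z)
  have := hconv.tangent_le hx hy (hd x)
  nlinarith

theorem sum_binomProb (k : ℕ) (p : ℝ) : ∑ v : Fin (k + 1), binomProb k p v = 1 := by
  rw [Fin.sum_univ_eq_sum_range (fun v => binomProb k p v)]
  simpa [Polynomial.eval_finsetSum, bernsteinPolynomial, binomProb] using
    congrArg (Polynomial.eval p) (bernsteinPolynomial.sum ℝ k)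

theorem sum_binomProb_mul_sub {k : ℕ} (hk : 1 ≤ k) (p : ℝ) :
    ∑ v : Fin (k + 1), binomProb k p v * ((v : ℕ) / (k : ℝ) - p) = 0 := by
  have hk' : (k : ℝ) ≠ 0 := by positivity
  have h : ∑ v : Fin (k + 1), ((v : ℕ) : ℝ) * binomProb k p v = k * p := by
    rw [Fin.sum_univ_eq_sum_range (fun v => (v : ℝ) * binomProb k p v)]
    simpa [Polynomial.eval_finsetSum, bernsteinPolynomial, binomProb] using
      congrArg (Polynomial.eval p) (bernsteinPolynomial.sum_smul ℝ k)
  calc _ = (∑ v : Fin (k + 1), ((v : ℕ) : ℝ) * binomProb k p v) / k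
        - p * ∑ v : Fin (k + 1), binomProb k p v := by
        rw [Finset.sum_div, Finset.mul_sum, ← Finset.sum_sub_distrib]
        exact Finset.sum_congr rfl fun v _ => by ring
    _ = 0 := by rw [h, sum_binomProb]; field_simp; ring

theorem sum_binomProb_mul_sub_sq {k : ℕ} (hk : 1 ≤ k) (p : ℝ) :
    ∑ v : Fin (k + 1), binomProb k p v * ((v : ℕ) / (k : ℝ) - p) ^ 2 = p * (1 - p) / k := by
  have hk' : (k : ℝ) ≠ 0 := by positivity
  have h : ∑ v : Fin (k + 1), (k * p - ((v : ℕ) : ℝ)) ^ 2 * binomProb k p v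
      = k * p * (1 - p) := by
    rw [Fin.sum_univ_eq_sum_range (fun v => (k * p - (v : ℝ)) ^ 2 * binomProb k p v)]
    simpa [Polynomial.eval_finsetSum, bernsteinPolynomial, binomProb] using
      congrArg (Polynomial.eval p) (bernsteinPolynomial.variance ℝ k)
  calc _ = (∑ v : Fin (k + 1), (k * p - ((v : ℕ) : ℝ)) ^ 2 * binomProb k p v) / k ^ 2 := by
        rw [Finset.sum_div]
        exact Finset.sum_congr rfl fun v _ => by field_simp; ring
    _ = _ := by rw [h]; field_simp

section ProductWeights

variable {ι κ : Type*} [Fintype ι] [DecidableEq ι] [Fintype κ]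

theorem sum_prod_mul_mul_of_ne {p x : ι → κ → ℝ} (h0 : ∀ q, ∑ v, p q v * x q v = 0)
    {q r : ι} (hqr : q ≠ r) :
    ∑ w : ι → κ, (∏ s, p s (w s)) * (x q (w q) * x r (w r)) = 0 := by
  have h : ∀ w : ι → κ, (∏ s, p s (w s)) * (x q (w q) * x r (w r)) =
      ∏ s, p s (w s) * ((if q = s then x s (w s) else 1) * (if r = s then x s (w s) else 1)) := by
    intro w
    simp only [Finset.prod_mul_distrib, Finset.prod_ite_eq, Finset.mem_univ, if_true]
  simp only [h]
  rw [← Fintype.prod_sum (fun s v =>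
    p s v * ((if q = s then x s v else 1) * (if r = s then x s v else 1)))]
  exact Finset.prod_eq_zero (Finset.mem_univ q) (by simpa [hqr.symm] using h0 q)

theorem sum_prod_mul {p : ι → κ → ℝ} (h1 : ∀ q, ∑ v, p q v = 1) (q : ι) (y : κ → ℝ) :
    ∑ w : ι → κ, (∏ s, p s (w s)) * y (w q) = ∑ v, p q v * y v := by
  have h : ∀ w : ι → κ, (∏ s, p s (w s)) * y (w q) =
      ∏ s, p s (w s) * (if q = s then y (w s) else 1) := by
    intro w
    simp only [Finset.prod_mul_distrib, Finset.prod_ite_eq, Finset.mem_univ, if_true]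
  simp only [h]
  rw [← Fintype.prod_sum (fun s v => p s v * (if q = s then y v else 1)),
    Finset.prod_eq_single q]
  · simp
  · intro s _ hs
    simp [hs.symm, h1]
  · simp

/-- Variance of a linear combination of independent centered variables. -/
theorem sum_prod_mul_sq {p x : ι → κ → ℝ} (h1 : ∀ q, ∑ v, p q v = 1)
    (h0 : ∀ q, ∑ v, p q v * x q v = 0) (a : ι → ℝ) :
    ∑ w : ι → κ, (∏ s, p s (w s)) * (∑ q, a q * x q (w q)) ^ 2 =
      ∑ q, a q ^ 2 * ∑ v, p q v * x q v ^ 2 := by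
  calc _ = ∑ q, ∑ r, a q * a r *
        ∑ w : ι → κ, (∏ s, p s (w s)) * (x q (w q) * x r (w r)) := by
        simp only [sq, Finset.sum_mul_sum]
        simp only [Finset.mul_sum]
        rw [Finset.sum_comm]
        refine Finset.sum_congr rfl fun q _ => ?_
        rw [Finset.sum_comm]
        exact Finset.sum_congr rfl fun r _ => Finset.sum_congr rfl fun w _ => by ring
    _ = _ := by
        refine Finset.sum_congr rfl fun q _ => ?_
        rw [Finset.sum_eq_single q]
        · rw [← sum_prod_mul h1 q (fun v => x q v ^ 2), sq]
          simp only [sq]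
        · intro r _ hr
          rw [sum_prod_mul_mul_of_ne h0 hr.symm, mul_zero]
        · simp

end ProductWeights

theorem sum_sum_ite_lt_eq_sum_subtype {d : ℕ} (f : Fin d → Fin d → ℝ) :
    (∑ i, ∑ j, if i < j then f i j else 0) =
      ∑ q : {q : Fin d × Fin d // q.1 < q.2}, f q.1.1 q.1.2 := by
  rw [← Fintype.sum_prod_type' (fun i j => if i < j then f i j else 0), ← Finset.sum_filter]
  exact (Finset.sum_subtype _ (by simp) (fun q : Fin d × Fin d => f q.1 q.2))

theorem sum_pairs_sub_sq {d : ℕ} {D : Fin d → ℝ} (hD : ∑ i, D i = 0) :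
    ∑ q : {q : Fin d × Fin d // q.1 < q.2}, (D q.1.1 - D q.1.2) ^ 2 = d * ∑ i, D i ^ 2 := by
  rw [← sum_sum_ite_lt_eq_sum_subtype (fun i j => (D i - D j) ^ 2)]
  have hfull : ∑ i, ∑ j, (D i - D j) ^ 2 = 2 * (d * ∑ i, D i ^ 2) := by
    have h : ∀ i j, (D i - D j) ^ 2 = D i ^ 2 - 2 * D i * D j + D j ^ 2 := fun i j => by ring
    simp only [h, Finset.sum_add_distrib, Finset.sum_sub_distrib, ← Finset.mul_sum, hD]
    simp [← Finset.mul_sum]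
    ring
  have hsplit : ∑ i, ∑ j, (D i - D j) ^ 2 =
      (∑ i, ∑ j, if i < j then (D i - D j) ^ 2 else 0) +
        ∑ i, ∑ j, if j < i then (D i - D j) ^ 2 else 0 := by
    simp only [← Finset.sum_add_distrib]
    refine Finset.sum_congr rfl fun i _ => Finset.sum_congr rfl fun j _ => ?_
    rcases lt_trichotomy i j with h | rfl | h
    · simp [h, h.not_gt]
    · simp
    · simp [h, h.not_gt]
  have hswap : (∑ i, ∑ j, if j < i then (D i - D j) ^ 2 else 0) =
      ∑ i, ∑ j, if i < j then (D i - D j) ^ 2 else 0 := by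
    rw [Finset.sum_comm]
    refine Finset.sum_congr rfl fun i _ => Finset.sum_congr rfl fun j _ => ?_
    rw [show (D j - D i) ^ 2 = (D i - D j) ^ 2 by ring]
  linarith

/-- Signed incidence of item `i` in the pair `q`. -/
def pairIncidence {d : ℕ} (i : Fin d) (q : {q : Fin d × Fin d // q.1 < q.2}) : ℝ :=
  (if i = q.1.1 then 1 else 0) - (if i = q.1.2 then 1 else 0)

theorem sum_pairIncidence_mul {d : ℕ} (q : {q : Fin d × Fin d // q.1 < q.2}) (D : Fin d → ℝ) :
    ∑ i, pairIncidence i q * D i = D q.1.1 - D q.1.2 := by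
  simp [pairIncidence, sub_mul, Finset.sum_sub_distrib]

theorem sum_pairIncidence_sq {d : ℕ} (q : {q : Fin d × Fin d // q.1 < q.2}) :
    ∑ i, pairIncidence i q ^ 2 = 2 := by
  have h : ∀ i, pairIncidence i q ^ 2 = pairIncidence i q * pairIncidence i q := fun i => sq _
  simp only [h, sum_pairIncidence_mul]
  simp [pairIncidence, q.2.ne, q.2.ne']
  norm_num

theorem sum_sq_le_of_strong_convexity {d : ℕ} (hd : 0 < d) {κ : ℝ} (hκ : 0 < κ) {D : Fin d → ℝ}
    (hD : ∑ i, D i = 0) (x : {q : Fin d × Fin d // q.1 < q.2} → ℝ)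
    (h : κ / 2 * ∑ q : {q : Fin d × Fin d // q.1 < q.2}, (D q.1.1 - D q.1.2) ^ 2
      ≤ ∑ q, x q * (D q.1.1 - D q.1.2)) :
    ∑ i, D i ^ 2 ≤ 4 / (κ * d) ^ 2 * ∑ i, (∑ q, pairIncidence i q * x q) ^ 2 := by
  have hd' : (0 : ℝ) < d := by exact_mod_cast hd
  set g : Fin d → ℝ := fun i => ∑ q, pairIncidence i q * x q with hg
  have hinner : ∑ q, x q * (D q.1.1 - D q.1.2) = ∑ i, D i * g i := by
    simp only [← sum_pairIncidence_mul, hg, Finset.mul_sum]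
    rw [Finset.sum_comm]
    exact Finset.sum_congr rfl fun i _ => Finset.sum_congr rfl fun q _ => by ring
  have hm : 0 < κ * d := by positivity
  have hyoung : (κ * d) * ∑ i, D i * g i ≤ (κ * d) ^ 2 / 4 * ∑ i, D i ^ 2 + ∑ i, g i ^ 2 := by
    rw [Finset.mul_sum, Finset.mul_sum, ← Finset.sum_add_distrib]
    exact Finset.sum_le_sum fun i _ => by nlinarith [sq_nonneg (κ * d / 2 * D i - g i)]
  rw [sum_pairs_sub_sq hD, hinner] at h
  have h2 := mul_le_mul_of_nonneg_left h hm.le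
  rw [div_mul_eq_mul_div, le_div_iff₀ (by positivity)]
  nlinarith

theorem log_exp_add_exp (a b : ℝ) :
    Real.log (Real.exp a + Real.exp b) = b + Real.log (1 + Real.exp (a - b)) := by
  rw [← Real.log_exp b, ← Real.log_mul (Real.exp_pos _).ne' (by positivity), Real.log_exp,
    mul_add, ← Real.exp_add]
  congr 1
  rw [add_sub_cancel]
  ring

theorem nll_winFrac_eq {d k : ℕ} (hk : 1 ≤ k) (w : BTLOutcome d k) (θ : Fin d → ℝ) :
    nll d k (winFrac d k w) θ = k * ∑ q : {q : Fin d × Fin d // q.1 < q.2},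
      (Real.log (1 + Real.exp (θ q.1.1 - θ q.1.2))
        - ((w q : ℕ) : ℝ) / k * (θ q.1.1 - θ q.1.2)) := by
  have hk' : (k : ℝ) ≠ 0 := by positivity
  rw [nll, sum_sum_ite_lt_eq_sum_subtype]
  congr 1
  refine Finset.sum_congr rfl fun q _ => ?_
  have h1 : winCount d k w q.1.1 q.1.2 = w q := by simp [winCount, q.2]
  have h2 : winCount d k w q.1.2 q.1.1 = k - w q := by simp [winCount, q.2, q.2.not_gt]
  have h3 : ((w q : ℕ)) ≤ k := Nat.lt_succ_iff.1 (w q).2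
  rw [winFrac, winFrac, h1, h2, log_exp_add_exp, Nat.cast_sub h3]
  field_simp
  ring

theorem sub_mem_Icc_of_mem_paramSet {d : ℕ} {A : ℝ} {θ : Fin d → ℝ} (hθ : θ ∈ paramSet d A)
    (i j : Fin d) : θ i - θ j ∈ Set.Icc (-(2 * A)) (2 * A) := by
  have hi := abs_le.1 ((norm_le_pi_norm θ i).trans hθ.1)
  have hj := abs_le.1 ((norm_le_pi_norm θ j).trans hθ.1)
  constructor <;> linarith [hi.1, hi.2, hj.1, hj.2]

theorem sum_sq_sub_le_of_nll_le {d k : ℕ} (hd : 0 < d) (hk : 1 ≤ k) {A : ℝ} (w : BTLOutcome d k)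
    {θ η : Fin d → ℝ} (hθ : θ ∈ paramSet d A) (hη : η ∈ paramSet d A)
    (h : nll d k (winFrac d k w) η ≤ nll d k (winFrac d k w) θ) :
    ∑ i, (η i - θ i) ^ 2 ≤ 4 / (sigmoid (-(2 * A)) ^ 2 * d) ^ 2 *
      ∑ i, (∑ q : {q : Fin d × Fin d // q.1 < q.2},
        pairIncidence i q * (((w q : ℕ) : ℝ) / k - sigmoid (θ q.1.1 - θ q.1.2))) ^ 2 := by
  have hσ : 0 < sigmoid (-(2 * A)) := by
    rw [sigmoid_eq_real_sigmoid]; exact Real.sigmoid_pos _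
  refine sum_sq_le_of_strong_convexity (D := fun i => η i - θ i) hd (by positivity)
    (by simp [Finset.sum_sub_distrib, hθ.2, hη.2])
    (fun q => ((w q : ℕ) : ℝ) / k - sigmoid (θ q.1.1 - θ q.1.2)) ?_
  rw [nll_winFrac_eq hk, nll_winFrac_eq hk] at h
  have h := le_of_mul_le_mul_left h (by positivity)
  have hsum := Finset.sum_le_sum fun q (_ : q ∈ (Finset.univ :
      Finset {q : Fin d × Fin d // q.1 < q.2})) =>
    softplus_strong_convexity (sub_mem_Icc_of_mem_paramSet hθ q.1.1 q.1.2)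
      (sub_mem_Icc_of_mem_paramSet hη q.1.1 q.1.2)
  rw [← sub_nonneg, ← Finset.sum_sub_distrib] at h hsum
  rw [← sub_nonneg, Finset.mul_sum, ← Finset.sum_sub_distrib]
  refine (add_nonneg h hsum).trans_eq ?_
  rw [← Finset.sum_add_distrib]
  exact Finset.sum_congr rfl fun q _ => by ring

theorem outcomeProb_nonneg {d k : ℕ} (θ : Fin d → ℝ) (w : BTLOutcome d k) :
    0 ≤ outcomeProb d k θ w := by
  refine Finset.prod_nonneg fun q _ => ?_
  rw [binomProb, sigmoid_eq_real_sigmoid]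
  have h0 := Real.sigmoid_nonneg (θ q.1.1 - θ q.1.2)
  have h1 : 0 ≤ 1 - Real.sigmoid (θ q.1.1 - θ q.1.2) := sub_nonneg.2 (Real.sigmoid_le_one _)
  positivity

/-- The expected squared norm of the score vector is at most `d² / (2k)`. -/
theorem sum_outcomeProb_mul_score_sq_le {d k : ℕ} (hk : 1 ≤ k) (θ : Fin d → ℝ) :
    ∑ w : BTLOutcome d k, outcomeProb d k θ w *
      ∑ i, (∑ q : {q : Fin d × Fin d // q.1 < q.2},
        pairIncidence i q * (((w q : ℕ) : ℝ) / k - sigmoid (θ q.1.1 - θ q.1.2))) ^ 2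
      ≤ (d : ℝ) ^ 2 / (2 * k) := by
  have hk' : (0 : ℝ) < k := by exact_mod_cast hk
  calc _ = ∑ i, ∑ q : {q : Fin d × Fin d // q.1 < q.2}, pairIncidence i q ^ 2 *
        (sigmoid (θ q.1.1 - θ q.1.2) * (1 - sigmoid (θ q.1.1 - θ q.1.2)) / k) := by
        simp only [Finset.mul_sum]
        rw [Finset.sum_comm]
        refine Finset.sum_congr rfl fun i _ => ?_
        simp only [← sum_binomProb_mul_sub_sq hk]
        exact sum_prod_mul_sq
          (p := fun (q : {q : Fin d × Fin d // q.1 < q.2}) (v : Fin (k + 1)) =>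
            binomProb k (sigmoid (θ q.1.1 - θ q.1.2)) v)
          (x := fun q v => ((v : ℕ) : ℝ) / k - sigmoid (θ q.1.1 - θ q.1.2))
          (fun q => sum_binomProb _ _) (fun q => sum_binomProb_mul_sub hk _)
          (fun q => pairIncidence i q)
    _ = ∑ q : {q : Fin d × Fin d // q.1 < q.2},
        2 * (sigmoid (θ q.1.1 - θ q.1.2) * (1 - sigmoid (θ q.1.1 - θ q.1.2)) / k) := by
        rw [Finset.sum_comm]
        simp only [← Finset.sum_mul, sum_pairIncidence_sq]
    _ ≤ ∑ _q : {q : Fin d × Fin d // q.1 < q.2}, 1 / (2 * (k : ℝ)) := by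
        refine Finset.sum_le_sum fun q _ => ?_
        rw [← mul_div_assoc, div_le_div_iff₀ hk' (by positivity)]
        nlinarith [mul_nonneg hk'.le (sq_nonneg (sigmoid (θ q.1.1 - θ q.1.2) - 1 / 2))]
    _ ≤ _ := by
        have hcard : Fintype.card {q : Fin d × Fin d // q.1 < q.2} ≤ d ^ 2 := by
          refine (Fintype.card_subtype_le _).trans ?_
          simp [sq]
        have hcard' : (Fintype.card {q : Fin d × Fin d // q.1 < q.2} : ℝ) ≤ (d : ℝ) ^ 2 := by
          exact_mod_cast hcard
        rw [Finset.sum_const, Finset.card_univ, nsmul_eq_mul, mul_one_div]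
        gcongr

/-- Theorem 2(b): for any constants `A > B > 0` there is a
constant `c > 0` depending only on `A` and `B` such that for all `d ≥ 2`, `k ≥ 1`,
the stretched MLE (minimizer of the negative log-likelihood over `Θ_A`) satisfies
`sup_{θ* ∈ Θ_B} E[‖θ̂⁽ᴬ⁾ − θ*‖₂²] ≤ c/k`. -/
theorem stretched_mle_mse_upper_bound (B A : ℝ) (hB : 0 < B) (hAB : B < A) :
    ∃ c > (0 : ℝ), ∀ d k : ℕ, 2 ≤ d → 1 ≤ k →
      ∀ mle : BTLOutcome d k → Fin d → ℝ,
        (∀ w : BTLOutcome d k,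
          mle w ∈ paramSet d A ∧
            ∀ θ ∈ paramSet d A,
              nll d k (winFrac d k w) (mle w) ≤ nll d k (winFrac d k w) θ) →
        ∀ θstar ∈ paramSet d B,
          (∑ w : BTLOutcome d k,
              outcomeProb d k θstar w * ∑ i, (mle w i - θstar i) ^ 2) ≤
            c / (k : ℝ) := by
  have hσ : 0 < sigmoid (-(2 * A)) := by
    rw [sigmoid_eq_real_sigmoid]; exact Real.sigmoid_pos _
  refine ⟨2 / (sigmoid (-(2 * A)) ^ 2) ^ 2, by positivity, ?_⟩
  intro d k hd hk mle hmle θstar hθ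
  have hd' : (0 : ℝ) < d := by exact_mod_cast (by omega : 0 < d)
  have hk' : (0 : ℝ) < k := by exact_mod_cast hk
  have hθA : θstar ∈ paramSet d A := ⟨hθ.1.trans hAB.le, hθ.2⟩
  refine (Finset.sum_le_sum fun w _ => mul_le_mul_of_nonneg_left
    (sum_sq_sub_le_of_nll_le (by omega) hk w hθA (hmle w).1 ((hmle w).2 _ hθA))
    (outcomeProb_nonneg θstar w)).trans ?_
  simp only [mul_left_comm (outcomeProb d k θstar _)]
  rw [← Finset.mul_sum]
  refine (mul_le_mul_of_nonneg_left (sum_outcomeProb_mul_score_sq_le hk θstar)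
    (by positivity)).trans_eq ?_
  field_simp
  norm_num
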